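/- If a, b, c are the side lengths of a spherical triangle, then 2·T_R² + T_r² ≥ (s(a)² + s(b)² + s(c)²)·((s(a)+s(b)+s(c))/sin((a+b+c)/2)), with equality if and only if a = b = c. -/

import Mathlib

/-- The quantity `J` of a spherical triangle with side lengths `a, b, c`. -/
noncomputable def sphJ (a b c : ℝ) : ℝ :=
  Real.sqrt (Real.sin ((a + b - c) / 2) * Real.sin ((a + c - b) / 2) *
    Real.sin ((b + c - a) / 2))

/-- `tan R` for the circumradius `R` of a spherical triangle with side lengths `a, b, c`. -/
noncomputable def sphTanR (a b c : ℝ) : ℝ :=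
  2 * Real.sin (a / 2) * Real.sin (b / 2) * Real.sin (c / 2) /
    (sphJ a b c * Real.sqrt (Real.sin ((a + b + c) / 2)))

/-- `tan r` for the inradius `r` of a spherical triangle with side lengths `a, b, c`. -/
noncomputable def sphTanr (a b c : ℝ) : ℝ :=
  sphJ a b c / Real.sqrt (Real.sin ((a + b + c) / 2))

/-- Gerretsen's inequality `s² ≤ 4R² + 4Rr + 3r²` in terms of side lengths, with the remainder
identified. -/
theorem gerretsen_identity (x y z : ℝ) :
    2 * x ^ 2 * (8 * (x * y * z) ^ 2 + ((x + y - z) * (x + z - y) * (y + z - x)) ^ 2 -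
      (x + y - z) * (x + z - y) * (y + z - x) * ((x ^ 2 + y ^ 2 + z ^ 2) * (x + y + z))) =
    (x + y + z) * ((x + y - z) * (x + z - y) * (y + z - x)) * ((y - z) * (y + z - x)) ^ 2 +
      ((x ^ 2 + z ^ 2 - y ^ 2) * (x ^ 2 + y ^ 2 - z ^ 2) -
        x * ((x + y - z) * (x + z - y) * (y + z - x))) ^ 2 := by
  ring

theorem gerretsen_le {x y z : ℝ} (hx : 0 < x) (hy : 0 < y) (hz : 0 < z)
    (hxy : 0 < x + y - z) (hxz : 0 < x + z - y) (hyz : 0 < y + z - x) :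
    (x + y - z) * (x + z - y) * (y + z - x) * ((x ^ 2 + y ^ 2 + z ^ 2) * (x + y + z)) ≤
      8 * (x * y * z) ^ 2 + ((x + y - z) * (x + z - y) * (y + z - x)) ^ 2 := by
  have h := gerretsen_identity x y z
  refine sub_nonneg.mp (nonneg_of_mul_nonneg_right (h.symm ▸ ?_) (by positivity : 0 < 2 * x ^ 2))
  positivity

theorem eq_of_gerretsen_eq {x y z : ℝ} (hx : 0 < x) (hy : 0 < y) (hz : 0 < z)
    (hxy : 0 < x + y - z) (hxz : 0 < x + z - y) (hyz : 0 < y + z - x)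
    (heq : 8 * (x * y * z) ^ 2 + ((x + y - z) * (x + z - y) * (y + z - x)) ^ 2 =
      (x + y - z) * (x + z - y) * (y + z - x) * ((x ^ 2 + y ^ 2 + z ^ 2) * (x + y + z))) :
    y = z := by
  have h := gerretsen_identity x y z
  rw [heq, sub_self, mul_zero] at h
  have h1 : 0 < (x + y + z) * ((x + y - z) * (x + z - y) * (y + z - x)) := by positivity
  have h2 : ((y - z) * (y + z - x)) ^ 2 = 0 := by
    by_contra hne
    have := mul_pos h1 (lt_of_le_of_ne (sq_nonneg _) (Ne.symm hne))
    linarith [sq_nonneg ((x ^ 2 + z ^ 2 - y ^ 2) * (x ^ 2 + y ^ 2 - z ^ 2) -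
      x * ((x + y - z) * (x + z - y) * (y + z - x)))]
  rcases mul_eq_zero.mp (pow_eq_zero_iff two_ne_zero |>.mp h2) with h3 | h3 <;> linarith

theorem sin_lt_sin_add_sin {A B C : ℝ} (hA : 0 < A) (hB : 0 < B) (hC : 0 < C)
    (h : C < A + B) (hsum : A + B + C < Real.pi) :
    Real.sin C < Real.sin A + Real.sin B := by
  have h1 : Real.cos ((A + B) / 2) < Real.cos ((A - B) / 2) := by
    rw [← Real.cos_abs ((A - B) / 2)]
    exact Real.cos_lt_cos_of_nonneg_of_le_pi (abs_nonneg _) (by linarith)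
      (abs_lt.mpr ⟨by linarith, by linarith⟩)
  have h2 : 0 < Real.sin ((A + B) / 2) := Real.sin_pos_of_pos_of_lt_pi (by linarith) (by linarith)
  have h3 : Real.sin A + Real.sin B = 2 * Real.sin ((A + B) / 2) * Real.cos ((A - B) / 2) :=
    Real.sin_add_sin A B
  have h4 : Real.sin (A + B) = 2 * Real.sin ((A + B) / 2) * Real.cos ((A + B) / 2) := by
    rw [← Real.sin_two_mul]; ring_nf
  have h5 : Real.sin C - Real.sin (A + B) =
      2 * Real.sin ((C - (A + B)) / 2) * Real.cos ((C + (A + B)) / 2) :=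
    Real.sin_sub_sin C (A + B)
  have h6 : Real.sin ((C - (A + B)) / 2) < 0 :=
    Real.sin_neg_of_neg_of_neg_pi_lt (by linarith) (by linarith)
  have h7 : 0 < Real.cos ((C + (A + B)) / 2) :=
    Real.cos_pos_of_mem_Ioo ⟨by linarith, by linarith⟩
  nlinarith [mul_pos (neg_pos.mpr h6) h7, mul_pos h2 (sub_pos.mpr h1)]

theorem sin_mul_sin_le_chord {A B C : ℝ} (hB : 0 < B) (hC : 0 < C) (hsum : B + C < Real.pi) :
    Real.sin (A + B - C) * Real.sin (A + C - B) ≤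
      (Real.sin A + Real.sin B - Real.sin C) * (Real.sin A + Real.sin C - Real.sin B) := by
  have h0 : Real.sin (A + B - C) * Real.sin (A + C - B) =
      Real.sin A ^ 2 - Real.sin (B - C) ^ 2 := by
    rw [show A + B - C = A + (B - C) by ring, show A + C - B = A - (B - C) by ring,
      Real.sin_add, Real.sin_sub A]
    nlinarith [Real.sin_sq_add_cos_sq A, Real.sin_sq_add_cos_sq (B - C)]
  have h1 : Real.cos ((B + C) / 2) ≤ Real.cos ((B - C) / 2) := by
    rw [← Real.cos_abs ((B - C) / 2)]
    exact Real.cos_le_cos_of_nonneg_of_le_pi (abs_nonneg _) (by linarith)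
      (abs_le.mpr ⟨by linarith, by linarith⟩)
  have h2 : 0 < Real.cos ((B + C) / 2) := Real.cos_pos_of_mem_Ioo ⟨by linarith, by linarith⟩
  have h3 : Real.sin B - Real.sin C = 2 * Real.sin ((B - C) / 2) * Real.cos ((B + C) / 2) :=
    Real.sin_sub_sin B C
  have h4 : Real.sin (B - C) = 2 * Real.sin ((B - C) / 2) * Real.cos ((B - C) / 2) := by
    rw [← Real.sin_two_mul]; ring_nf
  have h5 : (Real.sin B - Real.sin C) ^ 2 ≤ Real.sin (B - C) ^ 2 := by
    rw [h3, h4, mul_pow, mul_pow _ (Real.cos ((B - C) / 2))]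
    gcongr
  rw [h0]
  linarith

theorem prod_sin_le_prod_chord {A B C : ℝ} (hA : 0 < A) (hB : 0 < B) (hC : 0 < C)
    (hBC : A < B + C) (hAC : B < A + C) (hAB : C < A + B) (hsum : A + B + C < Real.pi) :
    Real.sin (A + B - C) * Real.sin (A + C - B) * Real.sin (B + C - A) ≤
      (Real.sin A + Real.sin B - Real.sin C) * (Real.sin A + Real.sin C - Real.sin B) *
        (Real.sin B + Real.sin C - Real.sin A) := by
  have h1 := sin_mul_sin_le_chord (A := A) hB hC (by linarith)
  have h2 := sin_mul_sin_le_chord (A := B) hA hC (by linarith)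
  have h3 := sin_mul_sin_le_chord (A := C) hA hB (by linarith)
  rw [add_comm B A, add_comm (Real.sin B) (Real.sin A)] at h2
  rw [add_comm C A, add_comm C B, add_comm (Real.sin C) (Real.sin A),
    add_comm (Real.sin C) (Real.sin B)] at h3
  have pu : 0 < Real.sin (A + B - C) := Real.sin_pos_of_pos_of_lt_pi (by linarith) (by linarith)
  have pv : 0 < Real.sin (A + C - B) := Real.sin_pos_of_pos_of_lt_pi (by linarith) (by linarith)
  have pw : 0 < Real.sin (B + C - A) := Real.sin_pos_of_pos_of_lt_pi (by linarith) (by linarith)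
  have pu' := sub_pos.mpr (sin_lt_sin_add_sin hA hB hC hAB hsum)
  have pv' := sub_pos.mpr (sin_lt_sin_add_sin hA hC hB hAC (by linarith))
  have pw' := sub_pos.mpr (sin_lt_sin_add_sin hB hC hA hBC (by linarith))
  refine (sq_le_sq₀ (by positivity) (by positivity)).mp ?_
  calc _ = Real.sin (A + B - C) * Real.sin (A + C - B) *
        (Real.sin (A + B - C) * Real.sin (B + C - A)) *
        (Real.sin (A + C - B) * Real.sin (B + C - A)) := by ring
    _ ≤ _ := mul_le_mul (mul_le_mul h1 h2 (by positivity) (by positivity)) h3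
        (by positivity) (by positivity)
    _ = _ := by ring

theorem eq_of_sin_eq {A B : ℝ} (hA : 0 < A) (hB : 0 < B) (hsum : A + B < Real.pi)
    (h : Real.sin A = Real.sin B) : A = B := by
  have h1 : 2 * Real.sin ((A - B) / 2) * Real.cos ((A + B) / 2) = 0 := by
    rw [← Real.sin_sub_sin, h, sub_self]
  have h2 : 0 < Real.cos ((A + B) / 2) := Real.cos_pos_of_mem_Ioo ⟨by linarith, by linarith⟩
  have h3 : Real.sin ((A - B) / 2) = 0 := by
    rcases mul_eq_zero.mp h1 with h4 | h4
    · linarith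
    · exact absurd h4 h2.ne'
  have := (Real.sin_eq_zero_iff_of_lt_of_lt (by linarith) (by linarith)).mp h3
  linarith

/-- For a spherical triangle with side lengths `a, b, c` and `s x = sin (x/2)`,
`2 tan² R + tan² r ≥ (s a² + s b² + s c²)·((s a + s b + s c)/sin((a+b+c)/2))`,
with equality iff `a = b = c`. -/
theorem spherical_ineq2_left (a b c : ℝ)
    (ha : 0 < a) (hb : 0 < b) (hc : 0 < c)
    (habc : a < b + c) (hbac : b < a + c) (hcab : c < a + b)
    (hsum : a + b + c < 2 * Real.pi) :
    (Real.sin (a / 2) ^ 2 + Real.sin (b / 2) ^ 2 + Real.sin (c / 2) ^ 2) *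
        ((Real.sin (a / 2) + Real.sin (b / 2) + Real.sin (c / 2)) /
          Real.sin ((a + b + c) / 2)) ≤
      2 * sphTanR a b c ^ 2 + sphTanr a b c ^ 2 ∧
    (2 * sphTanR a b c ^ 2 + sphTanr a b c ^ 2 =
      (Real.sin (a / 2) ^ 2 + Real.sin (b / 2) ^ 2 + Real.sin (c / 2) ^ 2) *
        ((Real.sin (a / 2) + Real.sin (b / 2) + Real.sin (c / 2)) /
          Real.sin ((a + b + c) / 2)) ↔
      a = b ∧ b = c) := by
  have e1 : (a + b - c) / 2 = a / 2 + b / 2 - c / 2 := by ring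
  have e2 : (a + c - b) / 2 = a / 2 + c / 2 - b / 2 := by ring
  have e3 : (b + c - a) / 2 = b / 2 + c / 2 - a / 2 := by ring
  have hp : 0 < Real.sin ((a + b + c) / 2) :=
    Real.sin_pos_of_pos_of_lt_pi (by linarith) (by linarith)
  have pu : 0 < Real.sin ((a + b - c) / 2) :=
    Real.sin_pos_of_pos_of_lt_pi (by linarith) (by linarith)
  have pv : 0 < Real.sin ((a + c - b) / 2) :=
    Real.sin_pos_of_pos_of_lt_pi (by linarith) (by linarith)
  have pw : 0 < Real.sin ((b + c - a) / 2) :=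
    Real.sin_pos_of_pos_of_lt_pi (by linarith) (by linarith)
  have hD : 0 < Real.sin ((a + b - c) / 2) * Real.sin ((a + c - b) / 2) *
    Real.sin ((b + c - a) / 2) := by positivity
  have hDE := prod_sin_le_prod_chord (half_pos ha) (half_pos hb) (half_pos hc)
    (by linarith) (by linarith) (by linarith) (by linarith)
  rw [← e1, ← e2, ← e3] at hDE
  have hx : 0 < Real.sin (a / 2) := Real.sin_pos_of_pos_of_lt_pi (by linarith) (by linarith)
  have hy : 0 < Real.sin (b / 2) := Real.sin_pos_of_pos_of_lt_pi (by linarith) (by linarith)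
  have hz : 0 < Real.sin (c / 2) := Real.sin_pos_of_pos_of_lt_pi (by linarith) (by linarith)
  have hxy := sub_pos.mpr (sin_lt_sin_add_sin (half_pos ha) (half_pos hb) (half_pos hc)
    (by linarith) (by linarith))
  have hxz := sub_pos.mpr (sin_lt_sin_add_sin (half_pos ha) (half_pos hc) (half_pos hb)
    (by linarith) (by linarith))
  have hyz := sub_pos.mpr (sin_lt_sin_add_sin (half_pos hb) (half_pos hc) (half_pos ha)
    (by linarith) (by linarith))
  have hR : sphTanR a b c ^ 2 = (2 * Real.sin (a / 2) * Real.sin (b / 2) * Real.sin (c / 2)) ^ 2 /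
      (Real.sin ((a + b - c) / 2) * Real.sin ((a + c - b) / 2) * Real.sin ((b + c - a) / 2) *
        Real.sin ((a + b + c) / 2)) := by
    rw [sphTanR, sphJ, div_pow, mul_pow _ (Real.sqrt _), Real.sq_sqrt hD.le, Real.sq_sqrt hp.le]
  have hr : sphTanr a b c ^ 2 =
      Real.sin ((a + b - c) / 2) * Real.sin ((a + c - b) / 2) * Real.sin ((b + c - a) / 2) /
        Real.sin ((a + b + c) / 2) := by
    rw [sphTanr, sphJ, div_pow, Real.sq_sqrt hD.le, Real.sq_sqrt hp.le]
  rw [hR, hr]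
  have inj : Real.sin (a / 2) = Real.sin (b / 2) → Real.sin (b / 2) = Real.sin (c / 2) →
      a = b ∧ b = c := fun h1 h2 =>
    ⟨by linarith [eq_of_sin_eq (half_pos ha) (half_pos hb) (by linarith) h1],
      by linarith [eq_of_sin_eq (half_pos hb) (half_pos hc) (by linarith) h2]⟩
  have diag : a = b ∧ b = c → Real.sin ((a + b - c) / 2) * Real.sin ((a + c - b) / 2) *
      Real.sin ((b + c - a) / 2) = Real.sin (a / 2) ^ 3 ∧ Real.sin (b / 2) = Real.sin (a / 2) ∧
      Real.sin (c / 2) = Real.sin (a / 2) := by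
    rintro ⟨rfl, rfl⟩
    refine ⟨?_, rfl, rfl⟩
    rw [add_sub_cancel_right]
    ring
  generalize Real.sin ((a + b - c) / 2) * Real.sin ((a + c - b) / 2) *
    Real.sin ((b + c - a) / 2) = D at *
  generalize Real.sin ((a + b + c) / 2) = P at *
  generalize Real.sin (a / 2) = x at *
  generalize Real.sin (b / 2) = y at *
  generalize Real.sin (c / 2) = z at *
  have main := gerretsen_le hx hy hz hxy hxz hyz
  have main_eq := eq_of_gerretsen_eq hx hy hz hxy hxz hyz
  have main_eq' := eq_of_gerretsen_eq hz hx hy (by linarith) (by linarith) hxy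
  have hEq : (x + y - z) * (x + z - y) * (y + z - x) ≤ x * y * z := by
    have h1 : 0 ≤ (x + y - z) * (x - y) ^ 2 := by positivity
    have h2 : 0 ≤ (x + z - y) * (x - z) ^ 2 := by positivity
    have h3 : 0 ≤ (y + z - x) * (y - z) ^ 2 := by positivity
    linarith
  have hE : 0 < (x + y - z) * (x + z - y) * (y + z - x) := by positivity
  have hdiff : 2 * ((2 * x * y * z) ^ 2 / (D * P)) + D / P -
      (x ^ 2 + y ^ 2 + z ^ 2) * ((x + y + z) / P) =
      (8 * (x * y * z) ^ 2 + D ^ 2 - D * ((x ^ 2 + y ^ 2 + z ^ 2) * (x + y + z))) / (D * P) := by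
    field_simp
    ring
  generalize hEdef : (x + y - z) * (x + z - y) * (y + z - x) = E at *
  generalize hSdef : (x ^ 2 + y ^ 2 + z ^ 2) * (x + y + z) = S at *
  have hq : 0 < x * y * z := by positivity
  -- `t ↦ 8 q² / t + t` is decreasing on `(0, q]`
  have hdecr : (E - D) * (7 * (x * y * z) ^ 2) ≤
      E * (8 * (x * y * z) ^ 2 + D ^ 2) - D * (8 * (x * y * z) ^ 2 + E ^ 2) := by
    have hDE2 : D * E ≤ (x * y * z) ^ 2 := by
      rw [sq]; exact mul_le_mul (hDE.trans hEq) hEq hE.le hq.le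
    nlinarith [mul_nonneg (sub_nonneg.mpr hDE) (sub_nonneg.mpr hDE2)]
  have hkey : 0 ≤ (E - D) * (7 * (x * y * z) ^ 2) :=
    mul_nonneg (sub_nonneg.mpr hDE) (by positivity)
  have hmain := mul_le_mul_of_nonneg_left main hD.le
  have hpos : 0 ≤ 8 * (x * y * z) ^ 2 + D ^ 2 - D * S :=
    nonneg_of_mul_nonneg_right (by linarith : 0 ≤ E * _) hE
  refine ⟨sub_nonneg.mp (hdiff ▸ div_nonneg hpos (mul_pos hD hp).le), fun h => ?_, fun h => ?_⟩
  · have h0 : 8 * (x * y * z) ^ 2 + D ^ 2 - D * S = 0 := by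
      rw [h, sub_self] at hdiff
      exact (div_eq_zero_iff.mp hdiff.symm).resolve_right (mul_pos hD hp).ne'
    have h1 : E * (8 * (x * y * z) ^ 2 + D ^ 2 - D * S) = 0 := by rw [h0, mul_zero]
    have h2 : D * (8 * (x * y * z) ^ 2 + E ^ 2) = D * (E * S) := by linarith
    have h3 := mul_left_cancel₀ hD.ne' h2
    refine inj (main_eq' ?_) (main_eq h3)
    have e1 : (z + x - y) * (z + y - x) * (x + y - z) = E := by rw [← hEdef]; ring
    have e2 : (z ^ 2 + x ^ 2 + y ^ 2) * (z + x + y) = S := by rw [← hSdef]; ring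
    rw [e1, e2, show z * x * y = x * y * z by ring, h3]
  · obtain ⟨hDx, rfl, rfl⟩ := diag h
    refine sub_eq_zero.mp (hdiff.trans ?_)
    rw [hDx, ← hSdef]
    ring
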